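/- Let L be a continuous conditionally-complete lattice and let E be a quasisober topological space. For every L-valued maxitive measure ν on the Borel σ-algebra ℬ of E, the regular part ⌊ν⌋ is a regular maxitive measure on ℬ with cardinal density x ↦ ν⁺([x]); moreover, the regular part of ⌊ν⌋ equals ⌊ν⌋. -/

import Mathlib

open Set

universe u v

section OrderDefs
variable {L : Type u} [PartialOrder L]

/-- A filtered (nonempty, downward directed) subset of a poset. -/
def DirFiltered (F : Set L) : Prop :=
  F.Nonempty ∧ ∀ r ∈ F, ∀ s ∈ F, ∃ t ∈ F, t ≤ r ∧ t ≤ s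

/-- A filter of a poset: a filtered upper set. -/
def OrdFilter (F : Set L) : Prop :=
  DirFiltered F ∧ ∀ r ∈ F, ∀ s : L, r ≤ s → s ∈ F

/-- Every filter has an infimum. -/
def FilteredComplete (L : Type u) [PartialOrder L] : Prop :=
  ∀ F : Set L, OrdFilter F → ∃ i : L, IsGLB F i

/-- `s` is way-above `r`: for every filter `F` with an infimum below `r`, `s ∈ F`. -/
def WayAbove (s r : L) : Prop :=
  ∀ F : Set L, OrdFilter F → ∀ i : L, IsGLB F i → i ≤ r → s ∈ F

/-- The poset is continuous: for every `r`, the set of elements way-above `r`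
is a filter whose infimum is `r`. -/
def ContinuousPoset (L : Type u) [PartialOrder L] : Prop :=
  ∀ r : L, OrdFilter {s : L | WayAbove s r} ∧ IsGLB {s : L | WayAbove s r} r

/-- Conditional completeness: every nonempty set bounded above has a supremum. -/
def CondComplete (L : Type u) [PartialOrder L] : Prop :=
  ∀ S : Set L, S.Nonempty → BddAbove S → ∃ m : L, IsLUB S m

end OrderDefs

/-- A domain: a filtered-complete continuous poset with a least element. -/
def DomainPoset (L : Type u) [PartialOrder L] [OrderBot L] : Prop :=
  FilteredComplete L ∧ ContinuousPoset L

section TopDefs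
variable {E : Type v} [TopologicalSpace E]

/-- The saturation of a set: intersection of all open sets containing it. -/
def satur (A : Set E) : Set E := ⋂₀ {G : Set E | IsOpen G ∧ A ⊆ G}

/-- A set is saturated if it is an intersection of open sets. -/
def IsSatur (A : Set E) : Prop :=
  ∃ 𝒢 : Set (Set E), (∀ G ∈ 𝒢, IsOpen G) ∧ A = ⋂₀ 𝒢

/-- The collection 𝒬 of compact saturated subsets. -/
def CompactSat (E : Type v) [TopologicalSpace E] : Set (Set E) :=
  {A : Set E | IsCompact A ∧ IsSatur A}

/-- The Borel σ-algebra generated by open sets and compact saturated sets. -/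
def BorelM (E : Type v) [TopologicalSpace E] : MeasurableSpace E :=
  MeasurableSpace.generateFrom ({A : Set E | IsOpen A} ∪ CompactSat E)

/-- Borel subsets for the σ-algebra generated by opens and compact saturated sets. -/
def IsBorelSet (B : Set E) : Prop := @MeasurableSet E (BorelM E) B

/-- The collection 𝒦 of compact Borel subsets. -/
def CompactBorel (E : Type v) [TopologicalSpace E] : Set (Set E) :=
  {A : Set E | IsBorelSet A ∧ IsCompact A}

/-- `[x]` : the compact Borel set `↑{x} ∩ closure {x}`. -/
def ptClass (x : E) : Set E := satur {x} ∩ closure {x}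

end TopDefs

section MeasDefs
variable {L : Type u} {E : Type v} [PartialOrder L] [OrderBot L] [TopologicalSpace E]

/-- An L-valued maxitive measure on the Borel σ-algebra. -/
def Maxitive (ν : Set E → L) : Prop :=
  ν ∅ = ⊥ ∧ ∀ 𝒞 : Set (Set E), 𝒞.Finite → (∀ B ∈ 𝒞, IsBorelSet B) →
    IsLUB (ν '' 𝒞) (ν (⋃₀ 𝒞))

/-- σ-maxitivity. -/
def SigmaMaxitive (ν : Set E → L) : Prop :=
  Maxitive ν ∧ ∀ 𝒞 : Set (Set E), 𝒞.Countable → (∀ B ∈ 𝒞, IsBorelSet B) →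
    IsLUB (ν '' 𝒞) (ν (⋃₀ 𝒞))

/-- Complete maxitivity. -/
def CompletelyMaxitive (ν : Set E → L) : Prop :=
  Maxitive ν ∧ ∀ 𝒞 : Set (Set E), (∀ B ∈ 𝒞, IsBorelSet B) → IsBorelSet (⋃₀ 𝒞) →
    IsLUB (ν '' 𝒞) (ν (⋃₀ 𝒞))

/-- The set `{ν G : G open, G ⊇ B}`. -/
def outerVals (ν : Set E → L) (B : Set E) : Set L :=
  {l : L | ∃ G : Set E, IsOpen G ∧ B ⊆ G ∧ ν G = l}

/-- `νp` is the map `ν⁺ : B ↦ inf {ν G : G open, G ⊇ B}` on Borel sets. -/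
def IsNuPlus (ν νp : Set E → L) : Prop :=
  ∀ B : Set E, IsBorelSet B → IsGLB (outerVals ν B) (νp B)

/-- Outer-continuity. -/
def OuterContinuous (ν : Set E → L) : Prop :=
  ∀ B : Set E, IsBorelSet B → IsGLB (outerVals ν B) (ν B)

/-- Inner-continuity. -/
def InnerContinuous (ν : Set E → L) : Prop :=
  ∀ B : Set E, IsBorelSet B →
    IsLUB {l : L | ∃ K : Set E, IsBorelSet K ∧ IsCompact K ∧ K ⊆ B ∧ ν (satur K) = l} (ν B)

/-- Regularity: inner- and outer-continuity. -/
def RegularMeasure (ν : Set E → L) : Prop :=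
  InnerContinuous ν ∧ OuterContinuous ν

/-- Weak outer-continuity: `ν K = ν⁺ K` for every compact Borel `K`. -/
def WeaklyOuterContinuous (ν : Set E → L) : Prop :=
  ∀ K : Set E, IsBorelSet K → IsCompact K → IsGLB (outerVals ν K) (ν K)

/-- Weak inner-continuity (relative to a given `ν⁺ = νp`). -/
def WeaklyInnerContinuous (ν νp : Set E → L) : Prop :=
  ∀ G : Set E, IsOpen G →
    IsLUB {l : L | ∃ K : Set E, IsBorelSet K ∧ IsCompact K ∧ K ⊆ G ∧ νp K = l} (ν G)

/-- 𝒜-smoothness. -/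
def SmoothWrt (ν : Set E → L) (𝒜 : Set (Set E)) : Prop :=
  ∀ 𝒟 : Set (Set E), 𝒟.Nonempty → 𝒟 ⊆ 𝒜 → DirectedOn (· ⊇ ·) 𝒟 →
    IsGLB (ν '' 𝒟) (ν (⋂₀ 𝒟))

/-- Saturation of a maxitive measure: `ν K = ν (↑K)` for compact Borel `K`. -/
def SaturatedMeasure (ν : Set E → L) : Prop :=
  ∀ K : Set E, IsBorelSet K → IsCompact K → ν K = ν (satur K)

/-- Tightness: `inf {ν (E ∖ K) : K compact Borel} = 0`. -/
def TightMeasure (ν : Set E → L) : Prop :=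
  IsGLB {l : L | ∃ K : Set E, IsBorelSet K ∧ IsCompact K ∧ ν Kᶜ = l} (⊥ : L)

/-- `c` is a cardinal density of `ν`. -/
def IsCardinalDensity (ν : Set E → L) (c : E → L) : Prop :=
  ∀ B : Set E, IsBorelSet B → IsLUB (c '' B) (ν B)

/-- Upper semicontinuity of a map into the poset. -/
def UscMap (c : E → L) : Prop := ∀ t : L, IsOpen {x : E | WayAbove t (c x)}

/-- Upper compactness of a map into the poset. -/
def UpperCompactMap (c : E → L) : Prop :=
  ∀ t : L, WayAbove t (⊥ : L) → IsCompact {x : E | ¬ WayAbove t (c x)}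

/-- Continuity from above along decreasing sequences of Borel sets. -/
def ContinuousFromAbove (ν : Set E → L) : Prop :=
  ∀ B : ℕ → Set E, (∀ n, IsBorelSet (B n)) → (∀ n, B (n + 1) ⊆ B n) →
    IsGLB (Set.range fun n => ν (B n)) (ν (⋂ n, B n))

/-- An optimal measure: a σ-maxitive measure continuous from above. -/
def OptimalMeasure (ν : Set E → L) : Prop :=
  SigmaMaxitive ν ∧ ContinuousFromAbove ν

/-- `flo` is the regular part `⌊ν⌋` (relative to `νp = ν⁺`):
`⌊ν⌋(B) = sup {ν⁺(K) : K compact Borel, K ⊆ B}`. -/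
def RegPartRel (νp flo : Set E → L) : Prop :=
  ∀ B : Set E, IsBorelSet B →
    IsLUB {l : L | ∃ K : Set E, IsBorelSet K ∧ IsCompact K ∧ K ⊆ B ∧ νp K = l} (flo B)

end MeasDefs

section Borel
variable {E : Type v} [TopologicalSpace E]

theorem IsOpen.isBorelSet {G : Set E} (hG : IsOpen G) : IsBorelSet G :=
  MeasurableSpace.measurableSet_generateFrom (Or.inl hG)

theorem IsBorelSet.compl {B : Set E} (hB : IsBorelSet B) : IsBorelSet Bᶜ :=
  @MeasurableSet.compl E B (BorelM E) hB

theorem IsBorelSet.inter {A B : Set E} (hA : IsBorelSet A) (hB : IsBorelSet B) :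
    IsBorelSet (A ∩ B) :=
  @MeasurableSet.inter E (BorelM E) A B hA hB

theorem IsClosed.isBorelSet {F : Set E} (hF : IsClosed F) : IsBorelSet F := by
  simpa using hF.isOpen_compl.isBorelSet.compl

theorem isBorelSet_sUnion {𝒞 : Set (Set E)} (h𝒞 : 𝒞.Finite) (h : ∀ B ∈ 𝒞, IsBorelSet B) :
    IsBorelSet (⋃₀ 𝒞) :=
  @MeasurableSet.sUnion E (BorelM E) 𝒞 h𝒞.countable h

theorem subset_satur (A : Set E) : A ⊆ satur A :=
  subset_sInter fun _ hG => hG.2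

theorem satur_subset {A G : Set E} (hG : IsOpen G) (h : A ⊆ G) : satur A ⊆ G :=
  sInter_subset_of_mem ⟨hG, h⟩

theorem IsCompact.satur {K : Set E} (hK : IsCompact K) : IsCompact (satur K) := by
  refine isCompact_of_finite_subcover fun U hU hKU => ?_
  obtain ⟨t, ht⟩ := hK.elim_finite_subcover U hU ((subset_satur K).trans hKU)
  exact ⟨t, satur_subset (isOpen_biUnion fun i _ => hU i) ht⟩

theorem IsCompact.isBorelSet_satur {K : Set E} (hK : IsCompact K) : IsBorelSet (_root_.satur K) :=
  MeasurableSpace.measurableSet_generateFrom (Or.inr ⟨hK.satur, _, fun _ hG => hG.1, rfl⟩)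

theorem mem_ptClass_self (x : E) : x ∈ ptClass x :=
  ⟨subset_satur _ rfl, subset_closure rfl⟩

theorem inseparable_of_mem_ptClass {x y : E} (h : y ∈ ptClass x) : Inseparable x y :=
  inseparable_iff_forall_isOpen.2 fun _ hG =>
    ⟨fun hx => satur_subset hG (singleton_subset_iff.2 hx) h.1, fun hy => by
      obtain ⟨z, hz, rfl⟩ := mem_closure_iff.1 h.2 _ hG hy
      exact hz⟩

theorem ptClass_subset_of_isOpen {x : E} {G : Set E} (hG : IsOpen G) (hx : x ∈ G) :
    ptClass x ⊆ G :=
  inter_subset_left.trans (satur_subset hG (singleton_subset_iff.2 hx))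

theorem isBorelSet_ptClass (x : E) : IsBorelSet (ptClass x) :=
  isCompact_singleton.isBorelSet_satur.inter isClosed_closure.isBorelSet

theorem isCompact_ptClass (x : E) : IsCompact (ptClass x) :=
  isCompact_singleton.satur.inter_right isClosed_closure

theorem IsBorelSet.mem_iff_of_inseparable {B : Set E} (hB : IsBorelSet B) {x y : E}
    (h : Inseparable x y) : x ∈ B ↔ y ∈ B := by
  refine MeasurableSpace.generateFrom_induction _ (fun B _ => x ∈ B ↔ y ∈ B) ?_ Iff.rfl
    (fun _ _ ih => not_congr ih) (fun f _ ih => ?_) B hB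
  · rintro A (hA | ⟨-, 𝒢, h𝒢, rfl⟩) -
    · exact h.mem_open_iff hA
    · exact forall₂_congr fun G hG => h.mem_open_iff (h𝒢 G hG)
  · simp only [mem_iUnion]
    exact exists_congr ih

theorem IsBorelSet.ptClass_subset {B : Set E} (hB : IsBorelSet B) {x : E} (hx : x ∈ B) :
    ptClass x ⊆ B :=
  fun _ hy => (hB.mem_iff_of_inseparable (inseparable_of_mem_ptClass hy)).1 hx

end Borel

section Order
variable {L : Type u} [PartialOrder L]

theorem WayAbove.mono_right {s r r' : L} (h : WayAbove s r') (hr : r ≤ r') : WayAbove s r :=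
  fun F hF i hi hir => h F hF i hi (hir.trans hr)

theorem WayAbove.exists_le {s r : L} (h : WayAbove s r) {F : Set L} (hF : DirFiltered F)
    (hr : IsGLB F r) : ∃ l ∈ F, l ≤ s := by
  refine h {m | ∃ l ∈ F, l ≤ m} ⟨⟨?_, ?_⟩, ?_⟩ r ⟨?_, ?_⟩ le_rfl
  · exact hF.1.imp fun l hl => ⟨l, hl, le_rfl⟩
  · rintro a ⟨l, hl, hla⟩ b ⟨m, hm, hmb⟩
    obtain ⟨t, ht, htl, htm⟩ := hF.2 l hl m hm
    exact ⟨t, ⟨t, ht, le_rfl⟩, htl.trans hla, htm.trans hmb⟩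
  · rintro a ⟨l, hl, hla⟩ b hab
    exact ⟨l, hl, hla.trans hab⟩
  · rintro a ⟨l, hl, hla⟩
    exact (hr.1 hl).trans hla
  · exact fun a ha => hr.2 fun l hl => ha ⟨l, hl, le_rfl⟩

theorem ContinuousPoset.le_of_forall_wayAbove (h : ContinuousPoset L) {a r : L}
    (ha : ∀ s, WayAbove s r → a ≤ s) : a ≤ r :=
  (h r).2.2 fun s hs => ha s hs

end Order

section Monotone
variable {L : Type u} {E : Type v} [PartialOrder L] [TopologicalSpace E] {ν νp : Set E → L}

theorem IsNuPlus.le_of_subset_isOpen (hνp : IsNuPlus ν νp) {B G : Set E} (hB : IsBorelSet B)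
    (hG : IsOpen G) (hBG : B ⊆ G) : νp B ≤ ν G :=
  (hνp B hB).1 ⟨G, hG, hBG, rfl⟩

theorem IsNuPlus.le_of_subset_satur (hνp : IsNuPlus ν νp) {A B : Set E} (hA : IsBorelSet A)
    (hB : IsBorelSet B) (hAB : A ⊆ satur B) : νp A ≤ νp B := by
  refine (hνp B hB).2 ?_
  rintro _ ⟨G, hG, hBG, rfl⟩
  exact hνp.le_of_subset_isOpen hA hG (hAB.trans (satur_subset hG hBG))

theorem IsCardinalDensity.mono {c : E → L} (h : IsCardinalDensity ν c) {A B : Set E}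
    (hA : IsBorelSet A) (hB : IsBorelSet B) (hAB : A ⊆ B) : ν A ≤ ν B :=
  (h A hA).mono (h B hB) (image_mono hAB)

end Monotone

section Maxitive
variable {L : Type u} {E : Type v} [PartialOrder L] [OrderBot L] [TopologicalSpace E]
  {ν νp flo : Set E → L}

theorem Maxitive.mono (hν : Maxitive ν) {A B : Set E} (hA : IsBorelSet A) (hB : IsBorelSet B)
    (hAB : A ⊆ B) : ν A ≤ ν B := by
  have h := hν.2 {A, B} (toFinite _) (by rintro C (rfl | rfl) <;> assumption)
  rw [sUnion_pair, union_eq_self_of_subset_left hAB] at h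
  exact h.1 (mem_image_of_mem ν (mem_insert A {B}))

theorem Maxitive.dirFiltered_outerVals (hν : Maxitive ν) (B : Set E) :
    DirFiltered (outerVals ν B) := by
  refine ⟨⟨_, univ, isOpen_univ, subset_univ B, rfl⟩, ?_⟩
  rintro _ ⟨G, hG, hBG, rfl⟩ _ ⟨H, hH, hBH, rfl⟩
  have hGH := hG.inter hH
  exact ⟨_, ⟨G ∩ H, hGH, subset_inter hBG hBH, rfl⟩,
    hν.mono hGH.isBorelSet hG.isBorelSet inter_subset_left,
    hν.mono hGH.isBorelSet hH.isBorelSet inter_subset_right⟩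

theorem IsNuPlus.exists_isOpen_of_wayAbove (hνp : IsNuPlus ν νp) (hν : Maxitive ν) {x : E} {s : L}
    (hs : WayAbove s (νp (ptClass x))) : ∃ G, IsOpen G ∧ x ∈ G ∧ ν G ≤ s := by
  obtain ⟨_, ⟨G, hG, hxG, rfl⟩, hGs⟩ :=
    hs.exists_le (hν.dirFiltered_outerVals _) (hνp _ (isBorelSet_ptClass x))
  exact ⟨G, hG, hxG (mem_ptClass_self x), hGs⟩

/-- On a compact Borel set, `ν⁺` is determined by its values on point classes. -/
theorem IsNuPlus.isLUB_of_isCompact (hνp : IsNuPlus ν νp) (hcont : ContinuousPoset L)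
    (hν : Maxitive ν) {K : Set E} (hK : IsBorelSet K) (hKc : IsCompact K) :
    IsLUB ((fun x => νp (ptClass x)) '' K) (νp K) := by
  refine ⟨?_, fun u hu => hcont.le_of_forall_wayAbove fun s hs => ?_⟩
  · rintro _ ⟨x, hx, rfl⟩
    exact hνp.le_of_subset_satur (isBorelSet_ptClass x) hK
      ((hK.ptClass_subset hx).trans (subset_satur K))
  · have h : ∀ x : K, ∃ G, IsOpen G ∧ (x : E) ∈ G ∧ ν G ≤ s := fun x =>
      hνp.exists_isOpen_of_wayAbove hν (hs.mono_right (hu (mem_image_of_mem _ x.2)))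
    choose G hG hxG hGs using h
    obtain ⟨t, ht⟩ := hKc.elim_finite_subcover G hG fun x hx => mem_iUnion.2 ⟨⟨x, hx⟩, hxG _⟩
    simp_rw [← Finset.mem_coe, ← sUnion_image] at ht
    have hopen : ∀ B ∈ G '' (t : Set K), IsOpen B := forall_mem_image.2 fun x _ => hG x
    refine (hνp.le_of_subset_isOpen hK (isOpen_sUnion hopen) ht).trans
      ((hν.2 _ (t.finite_toSet.image G) fun B hB => (hopen B hB).isBorelSet).2 ?_)
    rintro _ ⟨_, ⟨x, -, rfl⟩, rfl⟩
    exact hGs x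

theorem RegPartRel.isCardinalDensity (hflo : RegPartRel νp flo) (hcont : ContinuousPoset L)
    (hν : Maxitive ν) (hνp : IsNuPlus ν νp) :
    IsCardinalDensity flo fun x => νp (ptClass x) := by
  refine fun B hB => ⟨?_, fun u hu => (hflo B hB).2 ?_⟩
  · rintro _ ⟨x, hx, rfl⟩
    exact (hflo B hB).1
      ⟨ptClass x, isBorelSet_ptClass x, isCompact_ptClass x, hB.ptClass_subset hx, rfl⟩
  · rintro _ ⟨K, hK, hKc, hKB, rfl⟩
    exact (hνp.isLUB_of_isCompact hcont hν hK hKc).2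
      fun l hl => hu (image_mono hKB hl)

theorem RegPartRel.apply_satur (hflo : RegPartRel νp flo) (hνp : IsNuPlus ν νp) {K : Set E}
    (hK : IsBorelSet K) (hKc : IsCompact K) : flo (satur K) = νp K := by
  refine le_antisymm ((hflo _ hKc.isBorelSet_satur).2 ?_)
    ((hflo _ hKc.isBorelSet_satur).1 ⟨K, hK, hKc, subset_satur K, rfl⟩)
  rintro _ ⟨K', hK', -, hsub, rfl⟩
  exact hνp.le_of_subset_satur hK' hK hsub

theorem RegPartRel.apply_of_isCompact (hflo : RegPartRel νp flo) (hνp : IsNuPlus ν νp) {K : Set E}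
    (hK : IsBorelSet K) (hKc : IsCompact K) : flo K = νp K := by
  refine le_antisymm ((hflo K hK).2 ?_) ((hflo K hK).1 ⟨K, hK, hKc, subset_rfl, rfl⟩)
  rintro _ ⟨K', hK', -, hsub, rfl⟩
  exact hνp.le_of_subset_satur hK' hK (hsub.trans (subset_satur K))

theorem RegPartRel.innerContinuous (hflo : RegPartRel νp flo) (hνp : IsNuPlus ν νp) :
    InnerContinuous flo := by
  intro B hB
  convert hflo B hB using 1
  ext l
  refine exists_congr fun K => and_congr_right fun hK => and_congr_right fun hKc => ?_
  rw [hflo.apply_satur hνp hK hKc]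

theorem IsCardinalDensity.maxitive {c : E → L} (h : IsCardinalDensity ν c) : Maxitive ν := by
  refine ⟨?_, fun 𝒞 h𝒞 hB => ⟨?_, fun u hu => ?_⟩⟩
  · have h0 := h ∅ isOpen_empty.isBorelSet
    rw [image_empty] at h0
    exact h0.unique isLUB_empty
  · rintro _ ⟨B, hBC, rfl⟩
    exact h.mono (hB B hBC) (isBorelSet_sUnion h𝒞 hB) (subset_sUnion_of_mem hBC)
  · refine (h _ (isBorelSet_sUnion h𝒞 hB)).2 ?_
    rintro _ ⟨x, ⟨B, hBC, hx⟩, rfl⟩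
    exact ((h B (hB B hBC)).1 (mem_image_of_mem c hx)).trans (hu (mem_image_of_mem ν hBC))

theorem RegPartRel.outerContinuous (hflo : RegPartRel νp flo) (hcont : ContinuousPoset L)
    (hν : Maxitive ν) (hνp : IsNuPlus ν νp) : OuterContinuous flo := by
  have hd := hflo.isCardinalDensity hcont hν hνp
  refine fun B hB => ⟨?_, fun m hm => hcont.le_of_forall_wayAbove fun s hs => ?_⟩
  · rintro _ ⟨G, hG, hBG, rfl⟩
    exact hd.mono hB hG.isBorelSet hBG
  · have h : ∀ x : B, ∃ G, IsOpen G ∧ (x : E) ∈ G ∧ ν G ≤ s := fun x =>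
      hνp.exists_isOpen_of_wayAbove hν (hs.mono_right ((hd B hB).1 (mem_image_of_mem _ x.2)))
    choose G hG hxG hGs using h
    have hU : IsOpen (⋃ x, G x) := isOpen_iUnion hG
    refine (hm ⟨_, hU, fun x hx => mem_iUnion.2 ⟨⟨x, hx⟩, hxG _⟩, rfl⟩).trans
      ((hd _ hU.isBorelSet).2 ?_)
    rintro _ ⟨y, hy, rfl⟩
    obtain ⟨x, hyx⟩ := mem_iUnion.1 hy
    exact (hνp.le_of_subset_isOpen (isBorelSet_ptClass y) (hG x)
      (ptClass_subset_of_isOpen (hG x) hyx)).trans (hGs x)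

end Maxitive

/-- the regular part `⌊ν⌋` is a regular maxitive measure with cardinal
density `x ↦ ν⁺([x])`, and the regular part of `⌊ν⌋` equals `⌊ν⌋`. -/
theorem stmt4 {L : Type u} {E : Type v} [Lattice L] [OrderBot L]
    [TopologicalSpace E] [QuasiSober E]
    (hcc : CondComplete L) (hcont : ContinuousPoset L)
    (ν νp flo : Set E → L) (hν : Maxitive ν) (hνp : IsNuPlus ν νp)
    (hflo : RegPartRel νp flo) :
    Maxitive flo ∧ RegularMeasure flo ∧
    IsCardinalDensity flo (fun x : E => νp (ptClass x)) ∧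
    (∀ flop floflo : Set E → L, IsNuPlus flo flop → RegPartRel flop floflo →
      ∀ B : Set E, IsBorelSet B → floflo B = flo B) := by
  have hd := hflo.isCardinalDensity hcont hν hνp
  have ho := hflo.outerContinuous hcont hν hνp
  refine ⟨hd.maxitive, ⟨hflo.innerContinuous hνp, ho⟩, hd, fun flop floflo hp hf B hB => ?_⟩
  refine (hf B hB).unique ?_
  convert hflo B hB using 1
  ext l
  refine exists_congr fun K => and_congr_right fun hK => and_congr_right fun hKc => ?_
  rw [(hp K hK).unique (ho K hK), hflo.apply_of_isCompact hνp hK hKc]
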